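/- arXiv:math/0510575 — 3 statements merged into one kernel-verified Lean document; each statement's English description precedes it below -/
import Mathlib

section
/- Let (Ω, F, (F_t)_{t≥0}, P) be a filtered probability space, E a measurable space, (Y_t)_{t≥0} an (F_t)-adapted E-valued process with Y_0 = y_0 P-a.s. for a fixed point y_0 ∈ E, and f : E → (0,∞) measurable. Suppose there is a family of measurable functions g_t : E → (0,∞), t ≥ 0, such that for all 0 ≤ s ≤ t one has E[f(Y_t) | F_s] = g_{t−s}(Y_s) P-a.s. and 0 < E[f(Y_t)] < ∞. Assume moreover: (a) for every s ≥ 0 and every y ∈ E the limit M_s(y) := lim_{t→∞} g_{t−s}(y)/g_t(y_0) exists in ℝ; (b) there is a measurable function C : [0,∞) × E → [0,∞) with g_{t−s}(y)/g_t(y_0) ≤ C(s,y) for all t > s and E[C(s, Y_s)] < ∞ for every s ≥ 0. Then the process (M_s(Y_s))_{s≥0} is a nonnegative P-martingale with respect to (F_t)_{t≥0}, and M_0(Y_0) = 1 P-a.s. -/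
open MeasureTheory ProbabilityTheory Filter
open scoped NNReal ENNReal Topology

/-- The penalization meta-theorem (martingale part): if `E[f(Y_t) | F_s] = g_{t-s}(Y_s)`,
`g_{t-s}(y)/g_t(y₀)` converges to `M_s(y)` as `t → ∞` with a domination `C(s,y)` that is
integrable along the process, then `(M_s(Y_s))_{s ≥ 0}` is a nonnegative `P`-martingale
with `M_0(Y_0) = 1` a.s. -/
theorem penalization_meta_martingale
    {Ω E : Type*} [m : MeasurableSpace Ω] [MeasurableSpace E]
    (P : Measure Ω) [IsProbabilityMeasure P]
    (F : MeasureTheory.Filtration ℝ≥0 m)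
    (Y : ℝ≥0 → Ω → E)
    (hYadapted : ∀ t, @Measurable Ω E (F t) _ (Y t))
    (y₀ : E) (hY0 : ∀ᵐ ω ∂P, Y 0 ω = y₀)
    (f : E → ℝ) (hfmeas : Measurable f) (hfpos : ∀ y, 0 < f y)
    (g : ℝ≥0 → E → ℝ) (hgmeas : ∀ t, Measurable (g t)) (hgpos : ∀ t y, 0 < g t y)
    (hmarkov : ∀ s t : ℝ≥0, s ≤ t →
      P[(fun ω => f (Y t ω)) | F s] =ᵐ[P] fun ω => g (t - s) (Y s ω))
    (hfint : ∀ t, Integrable (fun ω => f (Y t ω)) P)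
    (hfintpos : ∀ t, 0 < ∫ ω, f (Y t ω) ∂P)
    (M : ℝ≥0 → E → ℝ)
    (hlim : ∀ (s : ℝ≥0) (y : E),
      Tendsto (fun t : ℝ≥0 => g (t - s) y / g t y₀) atTop (nhds (M s y)))
    (C : ℝ≥0 → E → ℝ) (hCmeas : Measurable (Function.uncurry C))
    (hCnonneg : ∀ s y, 0 ≤ C s y)
    (hCbound : ∀ (s t : ℝ≥0) (y : E), s < t → g (t - s) y / g t y₀ ≤ C s y)
    (hCint : ∀ s, Integrable (fun ω => C s (Y s ω)) P) :
    Martingale (fun s ω => M s (Y s ω)) F P ∧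
      (∀ s : ℝ≥0, ∀ᵐ ω ∂P, 0 ≤ M s (Y s ω)) ∧
      (∀ᵐ ω ∂P, M 0 (Y 0 ω) = 1) := by
  have hseq : ∀ u : ℝ≥0, Tendsto (fun n : ℕ => (n : ℝ≥0) + (u + 1)) atTop atTop := fun u =>
    tendsto_atTop_mono (fun _ => le_self_add) tendsto_natCast_atTop_atTop
  have hlt : ∀ (u : ℝ≥0) (n : ℕ), u < (n : ℝ≥0) + (u + 1) := fun u n =>
    lt_of_lt_of_le (lt_add_one u) le_add_self
  have hMmeas : ∀ s, Measurable (M s) := fun s =>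
    measurable_of_tendsto_metrizable
      (fun n : ℕ => (hgmeas ((n : ℝ≥0) + (s + 1) - s)).div_const (g ((n : ℝ≥0) + (s + 1)) y₀))
      (tendsto_pi_nhds.2 fun y => (hlim s y).comp (hseq s))
  have hMnonneg : ∀ s y, 0 ≤ M s y := fun s y =>
    ge_of_tendsto' (hlim s y) fun t => (div_pos (hgpos _ _) (hgpos _ _)).le
  have hMle : ∀ s y, M s y ≤ C s y := fun s y =>
    le_of_tendsto (hlim s y) ((eventually_gt_atTop s).mono fun t ht => hCbound s t y ht)
  have hMYmeas : ∀ s, StronglyMeasurable[F s] fun ω => M s (Y s ω) := fun s =>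
    ((hMmeas s).comp (hYadapted s)).stronglyMeasurable
  have hMint : ∀ s, Integrable (fun ω => M s (Y s ω)) P := fun s =>
    (hCint s).mono' ((hMYmeas s).mono (F.le s)).aestronglyMeasurable
      (.of_forall fun ω => by
        rw [Real.norm_of_nonneg (hMnonneg _ _)]
        exact hMle _ _)
  have hratio_meas : ∀ s t : ℝ≥0,
      StronglyMeasurable[F s] fun ω => g (t - s) (Y s ω) / g t y₀ := fun s t =>
    (((hgmeas _).comp (hYadapted s)).div_const _).stronglyMeasurable
  have hratio_bound : ∀ s t : ℝ≥0, s < t → ∀ ω,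
      ‖g (t - s) (Y s ω) / g t y₀‖ ≤ C s (Y s ω) := fun s t hst ω => by
    rw [Real.norm_of_nonneg (div_pos (hgpos _ _) (hgpos _ _)).le]
    exact hCbound s t _ hst
  have hratio_int : ∀ s t : ℝ≥0, s < t →
      Integrable (fun ω => g (t - s) (Y s ω) / g t y₀) P := fun s t hst =>
    (hCint s).mono' ((hratio_meas s t).mono (F.le s)).aestronglyMeasurable
      (.of_forall (hratio_bound s t hst))
  have hratio_condExp : ∀ s t : ℝ≥0, s ≤ t →
      P[fun ω => (g t y₀)⁻¹ * f (Y t ω) | F s] =ᵐ[P] fun ω => g (t - s) (Y s ω) / g t y₀ := by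
    intro s t hst
    filter_upwards [condExp_smul (μ := P) (g t y₀)⁻¹ (fun ω => f (Y t ω)) (F s),
      hmarkov s t hst] with ω h₁ h₂
    rw [div_eq_inv_mul, ← h₂]
    exact h₁
  refine ⟨⟨hMYmeas, fun s u hsu => ?_⟩, fun s => .of_forall fun ω => hMnonneg _ _, ?_⟩
  · have hsut : ∀ n : ℕ, s < (n : ℝ≥0) + (u + 1) := fun n => hsu.trans_lt (hlt u n)
    have key := tendsto_condExp_unique (m := F s) (μ := P)
      (fun (n : ℕ) ω => g ((n : ℝ≥0) + (u + 1) - u) (Y u ω) / g ((n : ℝ≥0) + (u + 1)) y₀)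
      (fun (n : ℕ) ω => g ((n : ℝ≥0) + (u + 1) - s) (Y s ω) / g ((n : ℝ≥0) + (u + 1)) y₀)
      (fun ω => M u (Y u ω)) (fun ω => M s (Y s ω))
      (fun n => hratio_int _ _ (hlt u n)) (fun n => hratio_int _ _ (hsut n))
      (.of_forall fun ω => (hlim u _).comp (hseq u))
      (.of_forall fun ω => (hlim s _).comp (hseq u))
      _ (hCint u) _ (hCint s)
      (fun n => .of_forall (hratio_bound _ _ (hlt u n)))
      (fun n => .of_forall (hratio_bound _ _ (hsut n)))
      (fun n => by
        rw [condExp_of_stronglyMeasurable (F.le s) (hratio_meas s _) (hratio_int _ _ (hsut n))]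
        exact (condExp_congr_ae (hratio_condExp u _ (hlt u n).le).symm).trans
          ((condExp_condExp_of_le (F.mono hsu) (F.le u)).trans
            (hratio_condExp s _ (hsut n).le)))
    rwa [condExp_of_stronglyMeasurable (F.le s) (hMYmeas s) (hMint s)] at key
  · filter_upwards [hY0] with ω hω
    rw [hω]
    refine tendsto_nhds_unique (hlim 0 y₀) (tendsto_const_nhds.congr fun t => ?_)
    rw [tsub_zero, div_self (hgpos t y₀).ne']
end

section
/- Let (Ω, F, (F_t)_{t≥0}, P) be a filtered probability space, E a measurable space, (Y_t)_{t≥0} an (F_t)-adapted E-valued process with Y_0 = y_0 P-a.s. for a fixed point y_0 ∈ E, and f : E → (0,∞) measurable. Suppose there is a family of measurable functions g_t : E → (0,∞), t ≥ 0, such that for all 0 ≤ s ≤ t one has E[f(Y_t) | F_s] = g_{t−s}(Y_s) P-a.s. and 0 < E[f(Y_t)] < ∞. Assume: (a) for every s ≥ 0 and y ∈ E the limit M_s(y) := lim_{t→∞} g_{t−s}(y)/g_t(y_0) exists in ℝ; (b) there is a measurable C : [0,∞) × E → [0,∞) with g_{t−s}(y)/g_t(y_0) ≤ C(s,y) for all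 t > s and E[C(s, Y_s)] < ∞ for every s ≥ 0. Then for every s ≥ 0 and every Γ ∈ F_s, lim_{t→∞} E[1_Γ · f(Y_t)] / E[f(Y_t)] = E[1_Γ · M_s(Y_s)]. -/
open MeasureTheory ProbabilityTheory Filter
open scoped NNReal ENNReal Topology

/-- The penalization meta-theorem (martingale part): if `E[f(Y_t) | F_s] = g_{t-s}(Y_s)`,
`g_{t-s}(y)/g_t(y₀)` converges to `M_s(y)` as `t → ∞` with a domination `C(s,y)` that is
integrable along the process, then `(M_s(Y_s))_{s ≥ 0}` is a nonnegative `P`-martingale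
with `M_0(Y_0) = 1` a.s. -/
theorem penalization_meta_convergence
    {Ω E : Type*} [m : MeasurableSpace Ω] [MeasurableSpace E]
    (P : Measure Ω) [IsProbabilityMeasure P]
    (F : MeasureTheory.Filtration ℝ≥0 m)
    (Y : ℝ≥0 → Ω → E)
    (hYadapted : ∀ t, @Measurable Ω E (F t) _ (Y t))
    (y₀ : E) (hY0 : ∀ᵐ ω ∂P, Y 0 ω = y₀)
    (f : E → ℝ) (hfmeas : Measurable f) (hfpos : ∀ y, 0 < f y)
    (g : ℝ≥0 → E → ℝ) (hgmeas : ∀ t, Measurable (g t)) (hgpos : ∀ t y, 0 < g t y)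
    (hmarkov : ∀ s t : ℝ≥0, s ≤ t →
      P[(fun ω => f (Y t ω)) | F s] =ᵐ[P] fun ω => g (t - s) (Y s ω))
    (hfint : ∀ t, Integrable (fun ω => f (Y t ω)) P)
    (hfintpos : ∀ t, 0 < ∫ ω, f (Y t ω) ∂P)
    (M : ℝ≥0 → E → ℝ)
    (hlim : ∀ (s : ℝ≥0) (y : E),
      Tendsto (fun t : ℝ≥0 => g (t - s) y / g t y₀) atTop (nhds (M s y)))
    (C : ℝ≥0 → E → ℝ) (hCmeas : Measurable (Function.uncurry C))
    (hCnonneg : ∀ s y, 0 ≤ C s y)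
    (hCbound : ∀ (s t : ℝ≥0) (y : E), s < t → g (t - s) y / g t y₀ ≤ C s y)
    (hCint : ∀ s, Integrable (fun ω => C s (Y s ω)) P) :
    ∀ (s : ℝ≥0) (Γ : Set Ω), MeasurableSet[F s] Γ →
      Tendsto (fun t : ℝ≥0 => (∫ ω in Γ, f (Y t ω) ∂P) / ∫ ω, f (Y t ω) ∂P)
        atTop (nhds (∫ ω in Γ, M s (Y s ω) ∂P)) := by
  have setIntegral_eq (s t : ℝ≥0) (hst : s ≤ t) (Γ : Set Ω) (hΓ : MeasurableSet[F s] Γ) :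
      ∫ ω in Γ, f (Y t ω) ∂P = ∫ ω in Γ, g (t - s) (Y s ω) ∂P := by
    rw [← setIntegral_condExp (F.le s) (hfint t) hΓ]
    exact integral_congr_ae (ae_restrict_of_ae (hmarkov s t hst))
  have integral_eq (t : ℝ≥0) : ∫ ω, f (Y t ω) ∂P = g t y₀ := by
    rw [← setIntegral_univ, setIntegral_eq 0 t zero_le Set.univ MeasurableSet.univ,
      setIntegral_univ, tsub_zero]
    have h : (fun ω => g t (Y 0 ω)) =ᵐ[P] fun _ => g t y₀ := by
      filter_upwards [hY0] with ω hω
      rw [hω]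
    simp [integral_congr_ae h]
  intro s Γ hΓ
  have hdom : Tendsto (fun t : ℝ≥0 => ∫ ω in Γ, g (t - s) (Y s ω) / g t y₀ ∂P)
      atTop (nhds (∫ ω in Γ, M s (Y s ω) ∂P)) := by
    refine tendsto_integral_filter_of_dominated_convergence (fun ω => C s (Y s ω)) ?_ ?_
      (hCint s).integrableOn (ae_of_all _ fun ω => hlim s (Y s ω))
    · refine Eventually.of_forall fun t => Measurable.aestronglyMeasurable ?_
      exact ((hgmeas (t - s)).comp ((hYadapted s).mono (F.le s) le_rfl)).div_const _
    · filter_upwards [eventually_gt_atTop s] with t ht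
      refine ae_of_all _ fun ω => ?_
      rw [Real.norm_of_nonneg (div_pos (hgpos _ _) (hgpos _ _)).le]
      exact hCbound s t _ ht
  refine hdom.congr' ?_
  filter_upwards [eventually_ge_atTop s] with t ht
  rw [integral_div, setIntegral_eq s t ht Γ hΓ, integral_eq]
end

section
/- Let λ > 0 and let ψ : ℝ → [0,∞) be Borel with ∫_x^∞ ψ(z)e^{−λz}dz < ∞ for every x ∈ ℝ. Fix x ∈ ℝ, let (B_t)_{t≥0} be a standard Brownian motion started at 0, and set X_t := x + B_t − λt (Brownian motion with drift −λ started at x), with running maximum S_t = sup_{0≤u≤t} X_u and S_∞ := sup_{t≥0} X_t. Then S_∞ < ∞ a.s., the random variable ψ(S_∞)e^{λS_∞}/(2λ) is integrable with expectation e^{2λx}∫_x^∞ ψ(y)e^{−λy}dy, and for every t ≥ 0, a.s., E[ ψ(S_∞)e^{λS_∞}/(2λ) | F_t ] = ψ(S_t)·( e^{λS_t} − e^{λ(2X_t − S_t)} )/(2λ) + e^{2λX_t}·∫_{S_t}^∞ ψ(z)e^{−λz}dz, where (F_t) is the natural filtration of X. -/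
open MeasureTheory ProbabilityTheory Filter
open scoped NNReal ENNReal Topology

noncomputable section

/-- The natural filtration `F_t = σ(X_s : s ≤ t)` of a real-valued process indexed by `ℝ≥0`. -/
def natFiltration {Ω : Type*} [m : MeasurableSpace Ω] (X : ℝ≥0 → Ω → ℝ) :
    MeasureTheory.Filtration ℝ≥0 m where
  seq t := (⨆ s ∈ Set.Iic t, MeasurableSpace.comap (X s) Real.measurableSpace) ⊓ m
  mono' := fun s t hst =>
    inf_le_inf_right m (biSup_mono fun u (hu : u ∈ Set.Iic s) => le_trans hu hst)
  le' := fun _ => inf_le_right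

/-- The running supremum `S_t = sup_{0 ≤ u ≤ t} X_u` of a process indexed by `ℝ≥0`. -/
def runSup {Ω : Type*} (X : ℝ≥0 → Ω → ℝ) (t : ℝ≥0) (ω : Ω) : ℝ :=
  sSup ((fun u => X u ω) '' Set.Iic t)

/-- A real-valued process `X` indexed by `ℝ≥0` is a standard one-dimensional Brownian
motion started at `x` under `P`. -/
structure IsBrownianMotion {Ω : Type*} [m : MeasurableSpace Ω] (P : Measure Ω)
    (X : ℝ≥0 → Ω → ℝ) (x : ℝ) : Prop where
  stronglyMeasurable : ∀ t, StronglyMeasurable (X t)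
  init : ∀ᵐ ω ∂P, X 0 ω = x
  cont : ∀ᵐ ω ∂P, Continuous fun t => X t ω
  gauss_incr : ∀ s t : ℝ≥0, s ≤ t →
    P.map (fun ω => X t ω - X s ω) = gaussianReal 0 (t - s)
  indep_incr : ∀ s t : ℝ≥0, s ≤ t →
    Indep (MeasurableSpace.comap (fun ω => X t ω - X s ω) Real.measurableSpace)
      (natFiltration X s) P

/-- The increment over `[t, t + u]` of the process `B` with drift `-lam`. -/
def driftIncr {Ω : Type*} (B : ℝ≥0 → Ω → ℝ) (lam : ℝ) (t u : ℝ≥0) (ω : Ω) : ℝ :=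
  B (t + u) ω - B t ω - lam * u

/-- The part of `C` on which the drifted increments started at `t` stay below `y` at the grid
times `0, δ, …, nδ`. -/
def belowOnGrid {Ω : Type*} (B : ℝ≥0 → Ω → ℝ) (lam : ℝ) (t δ : ℝ≥0) (y : ℝ) (C : Set Ω)
    (n : ℕ) : Set Ω :=
  C ∩ {ω | ∀ i ≤ n, driftIncr B lam t (i * δ) ω < y}

section DriftIncr

variable {Ω : Type*} {B : ℝ≥0 → Ω → ℝ}

lemma driftIncr_zero (lam : ℝ) (t : ℝ≥0) (ω : Ω) : driftIncr B lam t 0 ω = 0 := by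
  simp [driftIncr]

lemma driftIncr_add (lam : ℝ) (t u v : ℝ≥0) (ω : Ω) :
    driftIncr B lam t (u + v) ω = driftIncr B lam t u ω + driftIncr B lam (t + u) v ω := by
  simp only [driftIncr, NNReal.coe_add, add_assoc]
  ring

lemma belowOnGrid_zero (lam : ℝ) (t δ : ℝ≥0) {y : ℝ} (hy : 0 < y) (C : Set Ω) :
    belowOnGrid B lam t δ y C 0 = C := by
  simp [belowOnGrid, driftIncr_zero, hy]

lemma belowOnGrid_succ (lam : ℝ) (t δ : ℝ≥0) (y : ℝ) (C : Set Ω) (n : ℕ) :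
    belowOnGrid B lam t δ y C (n + 1) =
      belowOnGrid B lam t δ y C n ∩ {ω | driftIncr B lam t ((n + 1 : ℕ) * δ) ω < y} := by
  ext ω
  simp only [belowOnGrid, Set.mem_inter_iff, Set.mem_ofPred_eq, Nat.le_add_one_iff]
  refine ⟨fun h => ⟨⟨h.1, fun i hi => h.2 i (Or.inl hi)⟩, h.2 _ (Or.inr rfl)⟩, fun h =>
    ⟨h.1.1, ?_⟩⟩
  rintro i (hi | rfl)
  exacts [h.1.2 i hi, h.2]

lemma continuous_driftIncr {lam : ℝ} {t : ℝ≥0} {ω : Ω} (h : Continuous fun s => B s ω) :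
    Continuous fun u => driftIncr B lam t u ω := by
  have := h.comp (continuous_const.add continuous_id : Continuous fun u : ℝ≥0 => t + u)
  exact (this.sub continuous_const).sub (continuous_const.mul NNReal.continuous_coe)

variable [m : MeasurableSpace Ω] {P : Measure Ω}

lemma measurable_natFiltration (hB : ∀ t, Measurable (B t)) {s t : ℝ≥0} (hst : s ≤ t) :
    Measurable[natFiltration B t] (B s) := by
  rw [measurable_iff_comap_le]
  exact le_inf (le_iSup₂_of_le s hst le_rfl) (hB s).comap_le

lemma measurable_driftIncr_natFiltration (hB : ∀ t, Measurable (B t)) (lam : ℝ)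
    {s t u : ℝ≥0} (h : t + u ≤ s) : Measurable[natFiltration B s] (driftIncr B lam t u) :=
  ((measurable_natFiltration hB h).sub
    (measurable_natFiltration hB (le_self_add.trans h))).sub measurable_const

lemma measurable_driftIncr (hB : ∀ t, Measurable (B t)) (lam : ℝ) (t u : ℝ≥0) :
    Measurable (driftIncr B lam t u) :=
  ((hB _).sub (hB _)).sub measurable_const

lemma measurableSet_belowOnGrid (hB : ∀ t, Measurable (B t)) (lam : ℝ) (t δ : ℝ≥0) (y : ℝ)
    {C : Set Ω} (hC : MeasurableSet[natFiltration B t] C) (n : ℕ) :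
    MeasurableSet[natFiltration B (t + n * δ)] (belowOnGrid B lam t δ y C n) := by
  refine MeasurableSet.inter ((natFiltration B).mono le_self_add _ hC) ?_
  simp only [Set.ofPred_forall]
  refine MeasurableSet.iInter fun i => MeasurableSet.iInter fun hi => ?_
  refine measurable_driftIncr_natFiltration hB lam ?_ measurableSet_Iio
  gcongr

lemma IsBrownianMotion.measurable {x : ℝ} (hB : IsBrownianMotion P B x) (t : ℝ≥0) :
    Measurable (B t) := (hB.stronglyMeasurable t).measurable

lemma lintegral_exp_driftIncr {x : ℝ} (hB : IsBrownianMotion P B x) (a lam : ℝ) (t u : ℝ≥0) :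
    ∫⁻ ω, ENNReal.ofReal (Real.exp (a * driftIncr B lam t u ω)) ∂P =
      ENNReal.ofReal (Real.exp ((a ^ 2 / 2 - a * lam) * u)) := by
  have hmap := hB.gauss_incr t (t + u) le_self_add
  rw [add_tsub_cancel_left] at hmap
  have hm : Measurable fun ω => B (t + u) ω - B t ω := (hB.measurable _).sub (hB.measurable _)
  have hint : Integrable (fun z : ℝ => Real.exp (a * z)) (gaussianReal 0 u) :=
    integrable_exp_mul_gaussianReal a
  have hmgf := mgf_gaussianReal hmap a
  have key : ∫⁻ ω, ENNReal.ofReal (Real.exp (a * (B (t + u) ω - B t ω))) ∂P =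
      ENNReal.ofReal (Real.exp (u * a ^ 2 / 2)) := by
    rw [← ofReal_integral_eq_lintegral_ofReal]
    · rw [mgf] at hmgf
      rw [hmgf]
      simp
    · rw [← hmap] at hint
      exact hint.comp_measurable hm
    · exact ae_of_all _ fun _ => (Real.exp_pos _).le
  have : ∀ ω, ENNReal.ofReal (Real.exp (a * driftIncr B lam t u ω)) =
      ENNReal.ofReal (Real.exp (a * (B (t + u) ω - B t ω))) *
        ENNReal.ofReal (Real.exp (-(a * lam * u))) := fun ω => by
    rw [← ENNReal.ofReal_mul (Real.exp_pos _).le, ← Real.exp_add, driftIncr]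
    ring_nf
  simp_rw [this]
  rw [lintegral_mul_const _ (by fun_prop), key, ← ENNReal.ofReal_mul (Real.exp_pos _).le,
    ← Real.exp_add]
  ring_nf

lemma measure_diff_belowOnGrid_succ (hB : ∀ t, Measurable (B t)) (lam : ℝ) (t δ : ℝ≥0)
    (y : ℝ) {C : Set Ω} (hC : MeasurableSet[natFiltration B t] C) (n : ℕ) :
    P (C \ belowOnGrid B lam t δ y C (n + 1)) =
      P (C \ belowOnGrid B lam t δ y C n) +
        P (belowOnGrid B lam t δ y C n \ {ω | driftIncr B lam t ((n + 1 : ℕ) * δ) ω < y}) := by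
  rw [← measure_union]
  · congr 1
    rw [belowOnGrid_succ]
    ext ω
    have : ω ∈ belowOnGrid B lam t δ y C n → ω ∈ C := fun h => h.1
    simp only [Set.mem_sdiff, Set.mem_union, Set.mem_inter_iff]
    tauto
  · rw [Set.disjoint_left]
    exact fun ω h h' => h.2 h'.1
  · exact ((natFiltration B).le _ _ (measurableSet_belowOnGrid hB lam t δ y hC n)).diff
      (measurable_driftIncr hB _ _ _ measurableSet_Iio)

/-- The exponential martingale property of the drifted increments. -/
lemma setLIntegral_exp_driftIncr_add {x : ℝ} (hB : IsBrownianMotion P B x) (lam : ℝ)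
    (t u v : ℝ≥0) {A : Set Ω} (hA : MeasurableSet[natFiltration B (t + u)] A) :
    ∫⁻ ω in A, ENNReal.ofReal (Real.exp (2 * lam * driftIncr B lam t (u + v) ω)) ∂P =
      ∫⁻ ω in A, ENNReal.ofReal (Real.exp (2 * lam * driftIncr B lam t u ω)) ∂P := by
  have hA' : MeasurableSet A := (natFiltration B).le _ _ hA
  have hind := hB.indep_incr (t + u) (t + u + v) le_self_add
  have hprod := lintegral_mul_eq_lintegral_mul_lintegral_of_independent_measurableSpace
    (f := A.indicator fun ω => ENNReal.ofReal (Real.exp (2 * lam * driftIncr B lam t u ω)))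
    (g := fun ω => ENNReal.ofReal (Real.exp (2 * lam * driftIncr B lam (t + u) v ω)))
    ((natFiltration B).le (t + u))
    ((hB.measurable _).sub (hB.measurable _)).comap_le hind.symm
    (Measurable.indicator (((measurable_driftIncr_natFiltration hB.measurable lam
      le_rfl).const_mul _).exp.ennreal_ofReal) hA)
    (by
      have : Measurable fun z : ℝ => ENNReal.ofReal (Real.exp (2 * lam * (z - lam * v))) := by
        fun_prop
      exact this.comp (comap_measurable _))
  rw [lintegral_exp_driftIncr hB, show ((2 * lam) ^ 2 / 2 - 2 * lam * lam) * (v : ℝ) = 0 by ring,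
    Real.exp_zero, ENNReal.ofReal_one, mul_one, lintegral_indicator hA'] at hprod
  rw [← hprod, ← lintegral_indicator hA']
  refine lintegral_congr fun ω => ?_
  by_cases hω : ω ∈ A
  · simp only [hω, Set.indicator_of_mem]
    rw [← ENNReal.ofReal_mul (Real.exp_pos _).le, ← Real.exp_add, driftIncr_add, mul_add]
  · simp [hω]

lemma setLIntegral_belowOnGrid_succ {x : ℝ} (hB : IsBrownianMotion P B x) (lam : ℝ) (t δ : ℝ≥0)
    (y : ℝ) {C : Set Ω} (hC : MeasurableSet[natFiltration B t] C) (n : ℕ) :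
    ∫⁻ ω in belowOnGrid B lam t δ y C n,
        ENNReal.ofReal (Real.exp (2 * lam * driftIncr B lam t (n * δ) ω)) ∂P =
      ∫⁻ ω in belowOnGrid B lam t δ y C (n + 1),
        ENNReal.ofReal (Real.exp (2 * lam * driftIncr B lam t ((n + 1 : ℕ) * δ) ω)) ∂P +
      ∫⁻ ω in belowOnGrid B lam t δ y C n \ {ω | driftIncr B lam t ((n + 1 : ℕ) * δ) ω < y},
        ENNReal.ofReal (Real.exp (2 * lam * driftIncr B lam t ((n + 1 : ℕ) * δ) ω)) ∂P := by
  rw [← setLIntegral_exp_driftIncr_add hB lam t (n * δ) δ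
    (measurableSet_belowOnGrid hB.measurable lam t δ y hC n),
    show (n : ℝ≥0) * δ + δ = (n + 1 : ℕ) * δ by push_cast; ring, belowOnGrid_succ]
  exact (lintegral_inter_add_sdiff _ _
    (measurable_driftIncr hB.measurable _ _ _ measurableSet_Iio)).symm

lemma measure_diff_belowOnGrid_le {x lam : ℝ} (hlam : 0 < lam) (hB : IsBrownianMotion P B x)
    (t δ : ℝ≥0) {y : ℝ} (hy : 0 < y) {C : Set Ω} (hC : MeasurableSet[natFiltration B t] C)
    (n : ℕ) :
    ∫⁻ ω in belowOnGrid B lam t δ y C n,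
        ENNReal.ofReal (Real.exp (2 * lam * driftIncr B lam t (n * δ) ω)) ∂P +
      ENNReal.ofReal (Real.exp (2 * lam * y)) * P (C \ belowOnGrid B lam t δ y C n) ≤ P C := by
  induction n with
  | zero => simp [belowOnGrid_zero lam t δ hy, driftIncr_zero]
  | succ n ih =>
    refine le_trans ?_ ih
    rw [setLIntegral_belowOnGrid_succ hB lam t δ y hC n,
      measure_diff_belowOnGrid_succ hB.measurable lam t δ y hC n, mul_add, add_assoc]
    gcongr _ + ?_
    rw [add_comm]
    gcongr
    rw [← setLIntegral_const]
    refine setLIntegral_mono_ae' (((natFiltration B).le _ _ (measurableSet_belowOnGrid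
      hB.measurable lam t δ y hC n)).diff
      (measurable_driftIncr hB.measurable _ _ _ measurableSet_Iio)) (ae_of_all _ fun ω hω => ?_)
    have : y ≤ driftIncr B lam t ((n + 1 : ℕ) * δ) ω := not_lt.1 hω.2
    gcongr

lemma le_measure_diff_belowOnGrid {x lam : ℝ} (hlam : 0 < lam) (hB : IsBrownianMotion P B x)
    (t : ℝ≥0) {δ : ℝ≥0} (hδ : 0 < δ) {y : ℝ} (hy : 0 < y) {η : ℝ} (hη : 0 < η)
    {C : Set Ω} (hC : MeasurableSet[natFiltration B t] C) (n : ℕ) :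
    P C ≤ ∫⁻ ω in belowOnGrid B lam t δ y C n,
        ENNReal.ofReal (Real.exp (2 * lam * driftIncr B lam t (n * δ) ω)) ∂P +
      ENNReal.ofReal (Real.exp (2 * lam * (y + η))) * P (C \ belowOnGrid B lam t δ y C n) +
      n * ENNReal.ofReal (Real.exp (2 * lam * y + lam * η - η ^ 2 / (2 * δ))) := by
  induction n with
  | zero => simp [belowOnGrid_zero lam t δ hy, driftIncr_zero]
  | succ n ih =>
    refine ih.trans ?_
    have hmeas : MeasurableSet (belowOnGrid B lam t δ y C n \
        {ω | driftIncr B lam t ((n + 1 : ℕ) * δ) ω < y}) :=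
      ((natFiltration B).le _ _ (measurableSet_belowOnGrid hB.measurable lam t δ y hC n)).diff
        (measurable_driftIncr hB.measurable _ _ _ measurableSet_Iio)
    have hovershoot : ∫⁻ ω in belowOnGrid B lam t δ y C n \
          {ω | driftIncr B lam t ((n + 1 : ℕ) * δ) ω < y},
          ENNReal.ofReal (Real.exp (2 * lam * driftIncr B lam t ((n + 1 : ℕ) * δ) ω)) ∂P ≤
        ENNReal.ofReal (Real.exp (2 * lam * (y + η))) *
          P (belowOnGrid B lam t δ y C n \
            {ω | driftIncr B lam t ((n + 1 : ℕ) * δ) ω < y}) +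
        ENNReal.ofReal (Real.exp (2 * lam * y + lam * η - η ^ 2 / (2 * δ))) := by
      have hδ' : (0 : ℝ) < δ := hδ
      have hgauss : ∫⁻ ω, ENNReal.ofReal (Real.exp (2 * lam * y - η ^ 2 / δ)) *
          ENNReal.ofReal (Real.exp ((2 * lam + η / δ) * driftIncr B lam (t + n * δ) δ ω)) ∂P =
          ENNReal.ofReal (Real.exp (2 * lam * y + lam * η - η ^ 2 / (2 * δ))) := by
        rw [lintegral_const_mul' _ _ ENNReal.ofReal_ne_top, lintegral_exp_driftIncr hB,
          ← ENNReal.ofReal_mul (Real.exp_pos _).le, ← Real.exp_add]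
        congr 2
        field_simp
        ring
      rw [← hgauss, ← setLIntegral_const]
      refine le_trans ?_ (add_le_add le_rfl (setLIntegral_le_lintegral (belowOnGrid B lam t δ y C n
        \ {ω | driftIncr B lam t ((n + 1 : ℕ) * δ) ω < y}) _))
      rw [← lintegral_add_left measurable_const]
      refine setLIntegral_mono_ae' hmeas (ae_of_all _ fun ω hω => ?_)
      have hlt : driftIncr B lam t (n * δ) ω < y := hω.1.2 n le_rfl
      have hsplit : driftIncr B lam t ((n + 1 : ℕ) * δ) ω =
          driftIncr B lam t (n * δ) ω + driftIncr B lam (t + n * δ) δ ω := by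
        rw [← driftIncr_add]
        push_cast
        ring_nf
      rw [hsplit]
      rcases le_or_gt (driftIncr B lam (t + n * δ) δ ω) η with hle | hgt
      · refine le_add_right ?_
        gcongr
      · refine le_add_left ?_
        rw [← ENNReal.ofReal_mul (Real.exp_pos _).le, ← Real.exp_add]
        gcongr
        have h1 : 0 ≤ η / δ * (driftIncr B lam (t + n * δ) δ ω - η) :=
          mul_nonneg (by positivity) (by linarith)
        have h2 : η / δ * η = η ^ 2 / δ := by ring
        nlinarith
    rw [setLIntegral_belowOnGrid_succ hB lam t δ y hC n,
      measure_diff_belowOnGrid_succ hB.measurable lam t δ y hC n,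
      mul_add (ENNReal.ofReal (Real.exp (2 * lam * (y + η))))]
    refine (add_le_add_left (add_le_add_left (add_le_add_right hovershoot _) _) _).trans_eq ?_
    rw [Nat.cast_add_one (R := ℝ≥0∞), add_mul, one_mul]
    abel

lemma measure_exists_grid_le {x lam : ℝ} (hlam : 0 < lam) (hB : IsBrownianMotion P B x)
    (t δ : ℝ≥0) {y : ℝ} (hy : 0 < y) {C : Set Ω} (hC : MeasurableSet[natFiltration B t] C) :
    P (C ∩ {ω | ∃ n : ℕ, y ≤ driftIncr B lam t (n * δ) ω}) ≤
      P C * ENNReal.ofReal (Real.exp (-(2 * lam * y))) := by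
  have hUnion : C ∩ {ω | ∃ n : ℕ, y ≤ driftIncr B lam t (n * δ) ω} =
      ⋃ n, C \ belowOnGrid B lam t δ y C n := by
    ext ω
    simp only [belowOnGrid, Set.mem_inter_iff, Set.mem_ofPred_eq, Set.mem_iUnion, Set.mem_sdiff,
      not_and, not_forall, not_lt]
    refine ⟨fun ⟨h, n, hn⟩ => ⟨n, h, fun _ => ⟨n, le_rfl, hn⟩⟩, fun ⟨n, h, h'⟩ => ⟨h, ?_⟩⟩
    obtain ⟨i, -, hi⟩ := h' h
    exact ⟨i, hi⟩
  have hmono : Monotone fun n => C \ belowOnGrid B lam t δ y C n := by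
    intro i j hij
    refine Set.sdiff_subset_sdiff_right fun ω hω => ?_
    exact ⟨hω.1, fun k hk => hω.2 k (hk.trans hij)⟩
  rw [hUnion, hmono.measure_iUnion]
  refine iSup_le fun n => ?_
  have h := le_add_self.trans (measure_diff_belowOnGrid_le hlam hB t δ hy hC n)
  calc P (C \ belowOnGrid B lam t δ y C n)
      = ENNReal.ofReal (Real.exp (2 * lam * y)) * P (C \ belowOnGrid B lam t δ y C n) *
          ENNReal.ofReal (Real.exp (-(2 * lam * y))) := by
        rw [mul_right_comm, ← ENNReal.ofReal_mul (Real.exp_pos _).le, ← Real.exp_add,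
          add_neg_cancel, Real.exp_zero, ENNReal.ofReal_one, one_mul]
    _ ≤ _ := by gcongr

lemma eventually_exists_grid_of_continuous {f : ℝ≥0 → ℝ} (hf : Continuous f) {y : ℝ} {u : ℝ≥0}
    (hu : y < f u) : ∀ᶠ k : ℕ in atTop, ∃ n : ℕ, y ≤ f (n * ((k + 1 : ℕ) : ℝ≥0)⁻¹) := by
  have hfloor : Tendsto (fun k : ℕ => ((⌊(u : ℝ) * (k + 1 : ℕ)⌋₊ : ℕ) : ℝ≥0) *
      ((k + 1 : ℕ) : ℝ≥0)⁻¹) atTop (𝓝 u) := by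
    rw [← NNReal.tendsto_coe]
    have h := (tendsto_nat_floor_mul_div_atTop u.2).comp
      ((tendsto_natCast_atTop_atTop (R := ℝ)).comp (tendsto_add_atTop_nat 1))
    refine h.congr fun k => ?_
    simp [div_eq_mul_inv]
  filter_upwards [(hf.tendsto u).comp hfloor |>.eventually (lt_mem_nhds hu)] with k hk
  exact ⟨_, hk.le⟩

/-- Upper bound for the law of the overall maximum of the drifted increments. -/
lemma measure_exists_lt_driftIncr_le {x lam : ℝ} (hlam : 0 < lam) (hB : IsBrownianMotion P B x)
    (t : ℝ≥0) {y : ℝ} (hy : 0 ≤ y) {C : Set Ω} (hC : MeasurableSet[natFiltration B t] C) :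
    P (C ∩ {ω | ∃ u, y < driftIncr B lam t u ω}) ≤
      P C * ENNReal.ofReal (Real.exp (-(2 * lam * y))) := by
  rcases hy.eq_or_lt with rfl | hy
  · simpa using measure_mono Set.inter_subset_left
  let G : ℕ → Set Ω := fun k =>
    C ∩ {ω | ∃ n : ℕ, y ≤ driftIncr B lam t (n * ((k + 1 : ℕ) : ℝ≥0)⁻¹) ω}
  have hmono : Monotone fun N => ⋂ k ≥ N, G k := fun N N' h =>
    Set.biInter_subset_biInter_left fun k (hk : N' ≤ k) => h.trans hk
  calc P (C ∩ {ω | ∃ u, y < driftIncr B lam t u ω}) ≤ P (⋃ N, ⋂ k ≥ N, G k) := by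
        refine measure_mono_ae ?_
        filter_upwards [hB.cont] with ω hω
        rintro ⟨hωC, u, hu⟩
        obtain ⟨N, hN⟩ := eventually_atTop.1
          (eventually_exists_grid_of_continuous (continuous_driftIncr hω) hu)
        exact Set.mem_iUnion.2 ⟨N, Set.mem_iInter₂.2 fun k hk => ⟨hωC, hN k hk⟩⟩
    _ ≤ _ := by
        rw [hmono.measure_iUnion]
        exact iSup_le fun N => (measure_mono (Set.biInter_subset_of_mem le_rfl)).trans
          (measure_exists_grid_le hlam hB t _ hy hC)

lemma setLIntegral_belowOnGrid_le {x : ℝ} {lam : ℝ} (hlam : 0 < lam) (hB : IsBrownianMotion P B x)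
    (t δ : ℝ≥0) (y : ℝ) {C : Set Ω} (hC : MeasurableSet[natFiltration B t] C) (n : ℕ) :
    ∫⁻ ω in belowOnGrid B lam t δ y C n,
        ENNReal.ofReal (Real.exp (2 * lam * driftIncr B lam t (n * δ) ω)) ∂P ≤
      ENNReal.ofReal (Real.exp (lam * y - lam ^ 2 / 2 * (n * δ))) := by
  have hgauss : ∫⁻ ω, ENNReal.ofReal (Real.exp (lam * y)) *
      ENNReal.ofReal (Real.exp (lam * driftIncr B lam t (n * δ) ω)) ∂P =
      ENNReal.ofReal (Real.exp (lam * y - lam ^ 2 / 2 * (n * δ))) := by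
    rw [lintegral_const_mul' _ _ ENNReal.ofReal_ne_top, lintegral_exp_driftIncr hB,
      ← ENNReal.ofReal_mul (Real.exp_pos _).le, ← Real.exp_add]
    push_cast
    ring_nf
  rw [← hgauss]
  refine (setLIntegral_mono_ae' ((natFiltration B).le _ _ (measurableSet_belowOnGrid
    hB.measurable lam t δ y hC n)) (ae_of_all _ fun ω hω => ?_)).trans
    (setLIntegral_le_lintegral _ _)
  have hlt : driftIncr B lam t (n * δ) ω < y := hω.2 n le_rfl
  rw [← ENNReal.ofReal_mul (Real.exp_pos _).le, ← Real.exp_add]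
  gcongr
  nlinarith

variable [IsProbabilityMeasure P]

/-- Lower bound for the law of the overall maximum of the drifted increments. -/
lemma le_measure_exists_le_driftIncr {x lam : ℝ} (hlam : 0 < lam) (hB : IsBrownianMotion P B x)
    (t : ℝ≥0) {y : ℝ} (hy : 0 < y) {C : Set Ω} (hC : MeasurableSet[natFiltration B t] C) :
    P C * ENNReal.ofReal (Real.exp (-(2 * lam * y))) ≤
      P (C ∩ {ω | ∃ u, y ≤ driftIncr B lam t u ω}) := by
  set E := C ∩ {ω | ∃ u, y ≤ driftIncr B lam t u ω}
  have hη : ∀ η : ℝ, 0 < η → P C ≤ ENNReal.ofReal (Real.exp (2 * lam * (y + η))) * P E := by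
    intro η hη
    have hbound : ∀ᶠ k : ℕ in atTop, P C ≤
        ENNReal.ofReal (Real.exp (lam * y - lam ^ 2 / 2 * k)) +
          ENNReal.ofReal (Real.exp (2 * lam * (y + η))) * P E +
          ENNReal.ofReal ((k : ℝ) ^ 2 * Real.exp (2 * lam * y + lam * η - η ^ 2 / 2 * k)) := by
      filter_upwards [eventually_gt_atTop 0] with k hk
      have hk' : (0 : ℝ≥0) < k := by exact_mod_cast hk
      have hk'' : (0 : ℝ) < k := by exact_mod_cast hk
      have h := le_measure_diff_belowOnGrid hlam hB t (δ := (k : ℝ≥0)⁻¹) (by positivity) hy hη hC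
        (k ^ 2)
      refine h.trans (add_le_add (add_le_add ?_ ?_) (le_of_eq ?_))
      · refine (setLIntegral_belowOnGrid_le hlam hB t _ y hC _).trans_eq ?_
        congr 4
        push_cast
        field_simp
      · gcongr
        rintro ω ⟨hωC, hω⟩
        simp only [belowOnGrid, Set.mem_inter_iff, Set.mem_ofPred_eq, not_and, not_forall,
          not_lt] at hω
        obtain ⟨i, -, hi⟩ := hω hωC
        exact ⟨hωC, _, hi⟩
      · rw [ENNReal.ofReal_mul (by positivity), ENNReal.ofReal_pow (by positivity),
          ENNReal.ofReal_natCast]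
        push_cast
        congr 4
        field_simp
    have hlim1 : Tendsto (fun k : ℕ => ENNReal.ofReal (Real.exp (lam * y - lam ^ 2 / 2 * k)))
        atTop (𝓝 0) := by
      rw [← ENNReal.ofReal_zero]
      refine ENNReal.tendsto_ofReal (Real.tendsto_exp_atBot.comp ?_)
      refine tendsto_atBot_add_const_left _ _ (tendsto_neg_atTop_atBot.comp ?_)
      exact tendsto_natCast_atTop_atTop.const_mul_atTop (by positivity)
    have hlim2 : Tendsto (fun k : ℕ => ENNReal.ofReal
        ((k : ℝ) ^ 2 * Real.exp (2 * lam * y + lam * η - η ^ 2 / 2 * k))) atTop (𝓝 0) := by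
      rw [← ENNReal.ofReal_zero]
      refine ENNReal.tendsto_ofReal ?_
      have h := ((tendsto_rpow_mul_exp_neg_mul_atTop_nhds_zero 2 (η ^ 2 / 2)
        (by positivity)).comp (tendsto_natCast_atTop_atTop (R := ℝ))).const_mul
          (Real.exp (2 * lam * y + lam * η))
      rw [mul_zero] at h
      refine h.congr fun k => ?_
      simp only [Function.comp_apply, Real.rpow_two]
      rw [sub_eq_add_neg, Real.exp_add _ (-_), neg_mul]
      ring
    have hlim := (hlim1.add_const (ENNReal.ofReal (Real.exp (2 * lam * (y + η))) * P E)).add hlim2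
    rw [zero_add, add_zero] at hlim
    exact ge_of_tendsto hlim hbound
  have hlim : Tendsto (fun η : ℝ => ENNReal.ofReal (Real.exp (2 * lam * (y + η))) * P E)
      (𝓝[>] 0) (𝓝 (ENNReal.ofReal (Real.exp (2 * lam * y)) * P E)) := by
    refine ENNReal.Tendsto.mul_const ?_ (Or.inr (measure_ne_top _ _))
    have : Continuous fun η : ℝ => ENNReal.ofReal (Real.exp (2 * lam * (y + η))) :=
      ENNReal.continuous_ofReal.comp (by fun_prop)
    simpa using (this.tendsto 0).mono_left nhdsWithin_le_nhds
  have h := ge_of_tendsto hlim (eventually_nhdsWithin_of_forall hη)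
  calc P C * ENNReal.ofReal (Real.exp (-(2 * lam * y)))
      ≤ ENNReal.ofReal (Real.exp (2 * lam * y)) * P E *
          ENNReal.ofReal (Real.exp (-(2 * lam * y))) := by gcongr
    _ = P E := by
        rw [mul_right_comm, ← ENNReal.ofReal_mul (Real.exp_pos _).le, ← Real.exp_add,
          add_neg_cancel, Real.exp_zero, ENNReal.ofReal_one, one_mul]

lemma ae_bddAbove_driftIncr {x lam : ℝ} (hlam : 0 < lam) (hB : IsBrownianMotion P B x)
    (t : ℝ≥0) : ∀ᵐ ω ∂P, BddAbove (Set.range fun u => driftIncr B lam t u ω) := by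
  have hlim : Tendsto (fun k : ℕ => ENNReal.ofReal (Real.exp (-(2 * lam * k)))) atTop (𝓝 0) := by
    rw [← ENNReal.ofReal_zero]
    refine ENNReal.tendsto_ofReal (Real.tendsto_exp_neg_atTop_nhds_zero.comp ?_)
    exact tendsto_natCast_atTop_atTop.const_mul_atTop (by positivity)
  rw [ae_iff]
  refine le_antisymm (ge_of_tendsto' hlim fun k => ?_) zero_le
  have h := measure_exists_lt_driftIncr_le hlam hB t (Nat.cast_nonneg k) MeasurableSet.univ
  rw [measure_univ, one_mul, Set.univ_inter] at h
  refine (measure_mono fun ω hω => ?_).trans h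
  by_contra hcon
  simp only [Set.mem_ofPred_eq, not_exists, not_lt] at hcon
  exact hω ⟨k, Set.forall_mem_range.2 hcon⟩

end DriftIncr

lemma DenseRange.ciSup_comp {ι γ : Type*} [TopologicalSpace γ] {e : ι → γ} (he : DenseRange e)
    {f : γ → ℝ} (hf : Continuous f) : ⨆ i, f (e i) = ⨆ a, f a := by
  rw [← Dense.ciSup' he hf, iSup_range' (fun a => f a) e]

/-- The overall maximum of the drifted increments started at `t`, as a measurable function. -/
def maxDriftIncr {Ω : Type*} (B : ℝ≥0 → Ω → ℝ) (lam : ℝ) (t : ℝ≥0) (ω : Ω) : ℝ :=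
  ⨆ n, driftIncr B lam t (TopologicalSpace.denseSeq ℝ≥0 n) ω

lemma expMeasure_Ioi {r : ℝ} (hr : 0 < r) (y : ℝ) :
    expMeasure r (Set.Ioi y) = if 0 ≤ y then ENNReal.ofReal (Real.exp (-(r * y))) else 1 := by
  have := isProbabilityMeasure_expMeasure hr
  rw [← Set.compl_Iic, prob_compl_eq_one_sub measurableSet_Iic, ← ofReal_cdf,
    cdf_expMeasure_eq hr, ← ENNReal.ofReal_one]
  split_ifs with h
  · rw [← ENNReal.ofReal_sub _ (by simp; positivity), sub_sub_cancel]
  · simp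

section MaxDriftIncr

variable {Ω : Type*} {B : ℝ≥0 → Ω → ℝ}

lemma maxDriftIncr_eq_iSup {lam : ℝ} {t : ℝ≥0} {ω : Ω} (h : Continuous fun s => B s ω) :
    maxDriftIncr B lam t ω = ⨆ u, driftIncr B lam t u ω :=
  (TopologicalSpace.denseRange_denseSeq ℝ≥0).ciSup_comp (continuous_driftIncr h)

variable [m : MeasurableSpace Ω] {P : Measure Ω}

lemma measurable_maxDriftIncr (hB : ∀ t, Measurable (B t)) (lam : ℝ) (t : ℝ≥0) :
    Measurable (maxDriftIncr B lam t) :=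
  Measurable.iSup fun _ => measurable_driftIncr hB _ _ _

variable [IsProbabilityMeasure P]

lemma measure_inter_lt_maxDriftIncr {x lam : ℝ} (hlam : 0 < lam) (hB : IsBrownianMotion P B x)
    (t : ℝ≥0) (y : ℝ) {C : Set Ω} (hC : MeasurableSet[natFiltration B t] C) :
    P (C ∩ {ω | y < maxDriftIncr B lam t ω}) = P C * expMeasure (2 * lam) (Set.Ioi y) := by
  have hset : ∀ z, P (C ∩ {ω | z < maxDriftIncr B lam t ω}) =
      P (C ∩ {ω | ∃ u, z < driftIncr B lam t u ω}) := fun z => by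
    refine measure_congr ?_
    filter_upwards [hB.cont, ae_bddAbove_driftIncr hlam hB t] with ω hω hbdd
    refine propext (and_congr_right fun _ => ?_)
    change z < maxDriftIncr B lam t ω ↔ ∃ u, z < driftIncr B lam t u ω
    rw [maxDriftIncr_eq_iSup hω]
    exact lt_ciSup_iff hbdd
  rw [hset, expMeasure_Ioi (by positivity)]
  split_ifs with hy
  · refine le_antisymm (measure_exists_lt_driftIncr_le hlam hB t hy hC) ?_
    have hlim : Tendsto (fun z : ℝ => P C * ENNReal.ofReal (Real.exp (-(2 * lam * z))))
        (𝓝[>] y) (𝓝 (P C * ENNReal.ofReal (Real.exp (-(2 * lam * y))))) := by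
      refine ENNReal.Tendsto.const_mul ?_ (Or.inr (measure_ne_top _ _))
      have : Continuous fun z : ℝ => ENNReal.ofReal (Real.exp (-(2 * lam * z))) :=
        ENNReal.continuous_ofReal.comp (by fun_prop)
      exact (this.tendsto y).mono_left nhdsWithin_le_nhds
    refine le_of_tendsto hlim (eventually_nhdsWithin_of_forall fun z (hz : y < z) => ?_)
    refine (le_measure_exists_le_driftIncr hlam hB t (hy.trans_lt hz) hC).trans
      (measure_mono ?_)
    rintro ω ⟨hωC, u, hu⟩
    exact ⟨hωC, u, hz.trans_le hu⟩
  · rw [mul_one]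
    congr 1
    refine Set.inter_eq_left.2 fun ω _ => ⟨0, ?_⟩
    rw [driftIncr_zero]
    exact not_le.1 hy

lemma map_restrict_maxDriftIncr {x lam : ℝ} (hlam : 0 < lam) (hB : IsBrownianMotion P B x)
    (t : ℝ≥0) {C : Set Ω} (hC : MeasurableSet[natFiltration B t] C) :
    (P.restrict C).map (maxDriftIncr B lam t) = P C • expMeasure (2 * lam) := by
  have := isProbabilityMeasure_expMeasure (r := 2 * lam) (by positivity)
  have hM := measurable_maxDriftIncr hB.measurable lam t
  have : IsFiniteMeasure (P C • expMeasure (2 * lam)) :=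
    (expMeasure (2 * lam)).smul_finite (measure_ne_top _ _)
  refine Measure.ext_of_Iic _ _ fun y => ?_
  rw [← Set.compl_Ioi, measure_compl measurableSet_Ioi (measure_ne_top _ _),
    measure_compl measurableSet_Ioi (measure_ne_top _ _),
    Measure.map_apply hM measurableSet_Ioi, Measure.map_apply hM MeasurableSet.univ,
    Measure.restrict_apply (hM measurableSet_Ioi), Set.inter_comm]
  change _ - P (C ∩ {ω | y < maxDriftIncr B lam t ω}) = _
  rw [measure_inter_lt_maxDriftIncr hlam hB t y hC]
  simp

/-- Independence of the overall maximum of the drifted increments from the past. -/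
lemma map_restrict_prodMk_maxDriftIncr {x lam : ℝ} (hlam : 0 < lam)
    (hB : IsBrownianMotion P B x) (t : ℝ≥0) {E : Type*} [MeasurableSpace E] {V : Ω → E}
    (hV : Measurable[natFiltration B t] V) {C : Set Ω}
    (hC : MeasurableSet[natFiltration B t] C) :
    (P.restrict C).map (fun ω => (V ω, maxDriftIncr B lam t ω)) =
      ((P.restrict C).map V).prod (expMeasure (2 * lam)) := by
  have := isProbabilityMeasure_expMeasure (r := 2 * lam) (by positivity)
  have hM := measurable_maxDriftIncr hB.measurable lam t
  have hV' : Measurable V := hV.mono ((natFiltration B).le t) le_rfl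
  refine (Measure.prod_eq fun A T hA hT => ?_).symm
  have h := congrArg (fun μ : Measure ℝ => μ T)
    (map_restrict_maxDriftIncr hlam hB t (hC.inter (hV hA)))
  simp only [Measure.map_apply hM hT, Measure.restrict_apply (hM hT), Measure.smul_apply,
    smul_eq_mul] at h
  rw [Measure.map_apply (hV'.prodMk hM) (hA.prod hT), Measure.map_apply hV' hA,
    Measure.restrict_apply ((hV'.prodMk hM) (hA.prod hT)), Measure.restrict_apply (hV' hA),
    Set.inter_comm (V ⁻¹' A), ← h]
  congr 1
  ext ω
  simp only [Set.mem_inter_iff, Set.mem_preimage, Set.mem_prod]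
  tauto

lemma condExp_comp_maxDriftIncr {x lam : ℝ} (hlam : 0 < lam) (hB : IsBrownianMotion P B x)
    (t : ℝ≥0) {E : Type*} [MeasurableSpace E] {V : Ω → E}
    (hV : Measurable[natFiltration B t] V) {G : E × ℝ → ℝ} (hG : Measurable G)
    (hint : Integrable (fun ω => G (V ω, maxDriftIncr B lam t ω)) P) :
    P[fun ω => G (V ω, maxDriftIncr B lam t ω) | natFiltration B t] =ᵐ[P]
      fun ω => ∫ z, G (V ω, z) ∂expMeasure (2 * lam) := by
  have := isProbabilityMeasure_expMeasure (r := 2 * lam) (by positivity)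
  have hM := measurable_maxDriftIncr hB.measurable lam t
  have hV' : Measurable V := hV.mono ((natFiltration B).le t) le_rfl
  have hΦ : StronglyMeasurable fun v => ∫ z, G (v, z) ∂expMeasure (2 * lam) :=
    hG.stronglyMeasurable.integral_prod_right'
  have hprod : ∀ C, MeasurableSet[natFiltration B t] C →
      Integrable G (((P.restrict C).map V).prod (expMeasure (2 * lam))) := fun C hC => by
    rw [← map_restrict_prodMk_maxDriftIncr hlam hB t hV hC,
      integrable_map_measure hG.aestronglyMeasurable (hV'.prodMk hM).aemeasurable]
    exact hint.integrableOn
  refine (ae_eq_condExp_of_forall_setIntegral_eq ((natFiltration B).le t) hint ?_ ?_ ?_).symm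
  · intro C hC _
    have h := (hprod C hC).integral_prod_left
    rwa [integrable_map_measure hΦ.aestronglyMeasurable hV'.aemeasurable] at h
  · intro C hC _
    have h := integral_prod G (hprod C hC)
    rw [← map_restrict_prodMk_maxDriftIncr hlam hB t hV hC,
      integral_map (hV'.prodMk hM).aemeasurable hG.aestronglyMeasurable,
      integral_map hV'.aemeasurable hΦ.aestronglyMeasurable] at h
    exact h.symm
  · exact (hΦ.measurable.comp hV).stronglyMeasurable.aestronglyMeasurable

end MaxDriftIncr

section ExpMeasure

variable {r c : ℝ} {f : ℝ → ℝ}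

lemma expMeasure_restrict_Ioi (r c : ℝ) :
    (expMeasure r).restrict (Set.Ioi c) =
      (volume.restrict (Set.Ioi c)).withDensity (exponentialPDF r) :=
  restrict_withDensity measurableSet_Ioi _

lemma toReal_exponentialPDF_smul (hr : 0 < r) (hc : 0 ≤ c) {z : ℝ} (hz : z ∈ Set.Ioi c) :
    (exponentialPDF r z).toReal • f z = r * Real.exp (-(r * z)) * f z := by
  rw [exponentialPDF_of_nonneg (hc.trans (le_of_lt hz)), ENNReal.toReal_ofReal (by positivity),
    smul_eq_mul]

lemma measurable_exponentialPDF (r : ℝ) : Measurable (exponentialPDF r) :=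
  (measurable_exponentialPDFReal r).ennreal_ofReal

lemma integrableOn_Ioi_expMeasure_iff (hr : 0 < r) (hc : 0 ≤ c) :
    IntegrableOn f (Set.Ioi c) (expMeasure r) ↔
      IntegrableOn (fun z => r * Real.exp (-(r * z)) * f z) (Set.Ioi c) := by
  rw [IntegrableOn, expMeasure_restrict_Ioi,
    integrable_withDensity_iff_integrable_smul' (measurable_exponentialPDF r)
      (ae_of_all _ fun _ => ENNReal.ofReal_lt_top)]
  exact integrableOn_congr_fun (fun z hz => toReal_exponentialPDF_smul hr hc hz)
    measurableSet_Ioi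

lemma setIntegral_Ioi_expMeasure (hr : 0 < r) (hc : 0 ≤ c) :
    ∫ z in Set.Ioi c, f z ∂expMeasure r =
      ∫ z in Set.Ioi c, r * Real.exp (-(r * z)) * f z := by
  rw [expMeasure_restrict_Ioi,
    integral_withDensity_eq_integral_toReal_smul (measurable_exponentialPDF r)
      (ae_of_all _ fun _ => ENNReal.ofReal_lt_top)]
  exact setIntegral_congr_fun measurableSet_Ioi fun z hz => toReal_exponentialPDF_smul hr hc hz

end ExpMeasure

section Kennedy

variable {lam : ℝ} {ψ : ℝ → ℝ} {a s : ℝ}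

lemma exp_density_mul_kennedy (hlam : 0 < lam) {z : ℝ} (hz : z ∈ Set.Ioi (s - a)) :
    2 * lam * Real.exp (-(2 * lam * z)) *
        (ψ (max s (a + z)) * Real.exp (lam * max s (a + z)) / (2 * lam)) =
      Real.exp (2 * lam * a) * (ψ (a + z) * Real.exp (-(lam * (a + z)))) := by
  have hz' : s - a < z := hz
  rw [max_eq_right (by linarith)]
  have hexp : Real.exp (-(2 * lam * z)) * Real.exp (lam * (a + z)) =
      Real.exp (2 * lam * a) * Real.exp (-(lam * (a + z))) := by
    rw [← Real.exp_add, ← Real.exp_add]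
    ring_nf
  field_simp
  linear_combination ψ (a + z) * hexp

lemma eqOn_Iic_kennedy :
    Set.EqOn (fun z => ψ (max s (a + z)) * Real.exp (lam * max s (a + z)) / (2 * lam))
      (fun _ => ψ s * Real.exp (lam * s) / (2 * lam)) (Set.Iic (s - a)) := fun z hz => by
  have hz' : z ≤ s - a := hz
  simp only [max_eq_left (show a + z ≤ s by linarith)]

lemma integrable_kennedy_expMeasure (hlam : 0 < lam)
    (hψ : IntegrableOn (fun z => ψ z * Real.exp (-(lam * z))) (Set.Ici s)) (has : a ≤ s) :
    Integrable (fun z => ψ (max s (a + z)) * Real.exp (lam * max s (a + z)) / (2 * lam))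
      (expMeasure (2 * lam)) := by
  have := isProbabilityMeasure_expMeasure (r := 2 * lam) (by positivity)
  rw [← integrableOn_univ, ← Set.Iic_union_Ioi (a := s - a), integrableOn_union]
  refine ⟨(integrableOn_congr_fun eqOn_Iic_kennedy measurableSet_Iic).2 (by simp), ?_⟩
  rw [integrableOn_Ioi_expMeasure_iff (by positivity) (by linarith),
    integrableOn_congr_fun (fun z hz => exp_density_mul_kennedy hlam hz) measurableSet_Ioi]
  have h := ((measurePreserving_add_left volume a).integrableOn_comp_preimage
    (MeasurableEquiv.addLeft a).measurableEmbedding).2 (hψ.mono_set Set.Ioi_subset_Ici_self)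
  rw [Set.preimage_const_add_Ioi] at h
  exact h.const_mul _

lemma integral_kennedy_expMeasure (hlam : 0 < lam)
    (hψ : IntegrableOn (fun z => ψ z * Real.exp (-(lam * z))) (Set.Ici s)) (has : a ≤ s) :
    ∫ z, ψ (max s (a + z)) * Real.exp (lam * max s (a + z)) / (2 * lam) ∂expMeasure (2 * lam) =
      ψ s * (Real.exp (lam * s) - Real.exp (lam * (2 * a - s))) / (2 * lam) +
        Real.exp (2 * lam * a) * ∫ z in Set.Ici s, ψ z * Real.exp (-(lam * z)) := by
  have := isProbabilityMeasure_expMeasure (r := 2 * lam) (by positivity)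
  have hint := integrable_kennedy_expMeasure hlam hψ has
  rw [← setIntegral_univ, ← Set.Iic_union_Ioi (a := s - a),
    setIntegral_union (Set.Iic_disjoint_Ioi le_rfl) measurableSet_Ioi hint.integrableOn
      hint.integrableOn, setIntegral_congr_fun measurableSet_Iic eqOn_Iic_kennedy,
    setIntegral_Ioi_expMeasure (by positivity) (by linarith),
    setIntegral_congr_fun measurableSet_Ioi fun z hz => exp_density_mul_kennedy hlam hz,
    integral_const_mul, integral_Ici_eq_integral_Ioi]
  have h := (measurePreserving_add_left volume a).setIntegral_preimage_emb
    (MeasurableEquiv.addLeft a).measurableEmbedding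
    (fun z => ψ z * Real.exp (-(lam * z))) (Set.Ioi s)
  rw [Set.preimage_const_add_Ioi] at h
  rw [h, setIntegral_const, ← cdf_eq_real, cdf_expMeasure_eq (by positivity),
    if_pos (by linarith), smul_eq_mul]
  have hexp : Real.exp (-(2 * lam * (s - a))) * Real.exp (lam * s) =
      Real.exp (lam * (2 * a - s)) := by
    rw [← Real.exp_add]
    ring_nf
  rw [← hexp]
  ring

end Kennedy

lemma runSup_eq_iSup_denseSeq {Ω : Type*} {X : ℝ≥0 → Ω → ℝ} {t : ℝ≥0} {ω : Ω}
    (h : Continuous fun u => X u ω) :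
    runSup X t ω = ⨆ n, X (TopologicalSpace.denseSeq (Set.Iic t) n) ω := by
  rw [runSup, sSup_image', (TopologicalSpace.denseRange_denseSeq (Set.Iic t)).ciSup_comp
    (f := fun u : Set.Iic t => X u ω) (h.comp continuous_subtype_val)]

lemma bddAbove_image_Iic {f : ℝ≥0 → ℝ} (hf : Continuous f) (t : ℝ≥0) :
    BddAbove (f '' Set.Iic t) := by
  rw [← Set.Icc_bot]
  exact (isCompact_Icc.image hf).bddAbove

lemma le_runSup {Ω : Type*} {X : ℝ≥0 → Ω → ℝ} {t : ℝ≥0} {ω : Ω}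
    (h : Continuous fun u => X u ω) : X t ω ≤ runSup X t ω :=
  le_csSup (bddAbove_image_Iic h t) ⟨t, Set.self_mem_Iic, rfl⟩

/-- The overall supremum splits at time `t` into the running supremum and the future supremum. -/
lemma sSup_range_eq_max {f : ℝ≥0 → ℝ} (h : BddAbove (Set.range f)) (t : ℝ≥0) :
    sSup (Set.range f) = max (sSup (f '' Set.Iic t)) (f t + ⨆ u, (f (t + u) - f t)) := by
  have hfut : BddAbove (Set.range fun u => f (t + u)) := h.mono (by grind)
  have hfut_eq : f t + ⨆ u, (f (t + u) - f t) = ⨆ u, f (t + u) := by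
    have := ciSup_sub hfut (f t)
    linarith
  rw [hfut_eq, iSup, ← csSup_union (h.mono (Set.image_subset_range _ _))
    ⟨_, t, Set.self_mem_Iic, rfl⟩ hfut (Set.range_nonempty _)]
  congr 1
  ext y
  constructor
  · rintro ⟨u, rfl⟩
    rcases le_total u t with hu | hu
    · exact Or.inl ⟨u, hu, rfl⟩
    · exact Or.inr ⟨u - t, by simp [add_tsub_cancel_of_le hu]⟩
  · rintro (⟨u, -, rfl⟩ | ⟨u, rfl⟩)
    exacts [⟨u, rfl⟩, ⟨t + u, rfl⟩]

lemma natFiltration_le_of_measurable {Ω : Type*} [MeasurableSpace Ω] {X Y : ℝ≥0 → Ω → ℝ}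
    {t : ℝ≥0} (h : ∀ s ≤ t, Measurable[natFiltration Y t] (X s)) :
    natFiltration X t ≤ natFiltration Y t :=
  inf_le_left.trans (iSup₂_le fun s hs => (h s hs).comap_le)

/-- Uniformly integrable closure of Kennedy's martingale under a Brownian motion with
drift `-λ` started at `x`: the overall maximum `S_∞` is finite a.s.,
`ψ(S_∞)e^{λS_∞}/(2λ)` is integrable with expectation `e^{2λx} ∫_x^∞ ψ(y)e^{-λy}dy`,
and its conditional expectation given `F_t` is
`ψ(S_t)(e^{λS_t} - e^{λ(2X_t - S_t)})/(2λ) + e^{2λX_t} ∫_{S_t}^∞ ψ(z)e^{-λz}dz`. -/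
theorem kennedy_closure_drifted
    {Ω : Type*} [m : MeasurableSpace Ω] (P : Measure Ω) [IsProbabilityMeasure P]
    (lam : ℝ) (hlam : 0 < lam)
    (ψ : ℝ → ℝ) (hψmeas : Measurable ψ) (hψnonneg : ∀ z, 0 ≤ ψ z)
    (hψint : ∀ x' : ℝ, IntegrableOn (fun z => ψ z * Real.exp (-(lam * z))) (Set.Ici x'))
    (x : ℝ) (B : ℝ≥0 → Ω → ℝ) (hB : IsBrownianMotion P B 0)
    (X : ℝ≥0 → Ω → ℝ) (hXdef : ∀ t ω, X t ω = x + B t ω - lam * t)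
    (Sinf : Ω → ℝ) (hSinf : ∀ ω, Sinf ω = sSup (Set.range fun t : ℝ≥0 => X t ω)) :
    (∀ᵐ ω ∂P, BddAbove (Set.range fun t : ℝ≥0 => X t ω)) ∧
      Integrable (fun ω => ψ (Sinf ω) * Real.exp (lam * Sinf ω) / (2 * lam)) P ∧
      (∫ ω, ψ (Sinf ω) * Real.exp (lam * Sinf ω) / (2 * lam) ∂P
        = Real.exp (2 * lam * x) * ∫ z in Set.Ici x, ψ z * Real.exp (-(lam * z))) ∧
      (∀ t : ℝ≥0,
        P[(fun ω => ψ (Sinf ω) * Real.exp (lam * Sinf ω) / (2 * lam)) | natFiltration X t]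
          =ᵐ[P] fun ω =>
            ψ (runSup X t ω) *
                (Real.exp (lam * runSup X t ω) - Real.exp (lam * (2 * X t ω - runSup X t ω)))
                / (2 * lam)
              + Real.exp (2 * lam * X t ω) *
                  ∫ z in Set.Ici (runSup X t ω), ψ z * Real.exp (-(lam * z))) := by
  have hBm := hB.measurable
  have hX_eq : ∀ t, X t = fun ω => x + B t ω - lam * t := fun t => funext (hXdef t)
  have hXm : ∀ t, Measurable (X t) := fun t => by
    rw [hX_eq]
    exact ((hBm t).const_add x).sub_const _
  have hfilt : ∀ t, natFiltration X t = natFiltration B t := fun t => by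
    refine le_antisymm (natFiltration_le_of_measurable fun s hs => ?_)
      (natFiltration_le_of_measurable fun s hs => ?_)
    · rw [hX_eq]
      exact ((measurable_natFiltration hBm hs).const_add x).sub_const _
    · have : B s = fun ω => X s ω - x + lam * s := by
        funext ω
        rw [hXdef]
        ring
      rw [this]
      exact ((measurable_natFiltration hXm hs).sub_const x).add_const _
  have hincr : ∀ t u ω, driftIncr B lam t u ω = X (t + u) ω - X t ω := fun t u ω => by
    rw [hXdef, hXdef, driftIncr]
    push_cast
    ring
  have hXcont : ∀ᵐ ω ∂P, Continuous fun t => X t ω := by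
    filter_upwards [hB.cont] with ω hω
    simp only [hXdef]
    exact (hω.const_add x).sub (continuous_const.mul NNReal.continuous_coe)
  have hbdd : ∀ᵐ ω ∂P, BddAbove (Set.range fun t : ℝ≥0 => X t ω) := by
    filter_upwards [ae_bddAbove_driftIncr hlam hB 0] with ω hω
    obtain ⟨b, hb⟩ := hω
    refine ⟨b + X 0 ω, Set.forall_mem_range.2 fun u => ?_⟩
    have := hb ⟨u, rfl⟩
    simp only [hincr, zero_add] at this
    linarith
  have hsplit : ∀ t, ∀ᵐ ω ∂P,
      Sinf ω = max (runSup X t ω) (X t ω + maxDriftIncr B lam t ω) := fun t => by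
    filter_upwards [hbdd, hB.cont] with ω hω hcont
    rw [hSinf, sSup_range_eq_max hω t, maxDriftIncr_eq_iSup hcont]
    simp only [hincr, runSup]
  have hg : Measurable fun z => ψ z * Real.exp (lam * z) / (2 * lam) := by fun_prop
  have hSinf_zero : (fun ω => ψ (Sinf ω) * Real.exp (lam * Sinf ω) / (2 * lam)) =ᵐ[P]
      (fun z => ψ (max x (x + z)) * Real.exp (lam * max x (x + z)) / (2 * lam)) ∘
        maxDriftIncr B lam 0 := by
    filter_upwards [hsplit 0, hB.init] with ω hω h0
    have hX0 : X 0 ω = x := by simp [hXdef, h0]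
    have hIic : Set.Iic (0 : ℝ≥0) = {0} := by ext u; simp
    have hrun : runSup X 0 ω = x := by simp [runSup, hIic, hX0]
    simp only [hω, hrun, hX0, Function.comp_apply]
  have hmap : P.map (maxDriftIncr B lam 0) = expMeasure (2 * lam) := by
    simpa using map_restrict_maxDriftIncr hlam hB 0 MeasurableSet.univ
  have hgmax : Measurable fun z =>
      ψ (max x (x + z)) * Real.exp (lam * max x (x + z)) / (2 * lam) :=
    hg.comp (measurable_const.max (measurable_id.const_add x))
  have hMm := measurable_maxDriftIncr hBm lam
  have hint : Integrable (fun ω => ψ (Sinf ω) * Real.exp (lam * Sinf ω) / (2 * lam)) P := by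
    rw [integrable_congr hSinf_zero, ← integrable_map_measure hgmax.aestronglyMeasurable
      (hMm 0).aemeasurable, hmap]
    exact integrable_kennedy_expMeasure hlam (hψint x) le_rfl
  refine ⟨hbdd, hint, ?_, fun t => ?_⟩
  · rw [integral_congr_ae hSinf_zero]
    simp only [Function.comp_apply]
    rw [← integral_map (hMm 0).aemeasurable hgmax.aestronglyMeasurable, hmap,
      integral_kennedy_expMeasure hlam (hψint x) le_rfl]
    ring_nf
  · have hrun : ∀ᵐ ω ∂P,
        runSup X t ω = ⨆ n, X (TopologicalSpace.denseSeq (Set.Iic t) n) ω := by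
      filter_upwards [hXcont] with ω hω using runSup_eq_iSup_denseSeq hω
    have hV : Measurable[natFiltration B t] fun ω =>
        (⨆ n, X (TopologicalSpace.denseSeq (Set.Iic t) n) ω, X t ω) := by
      rw [← hfilt]
      exact Measurable.prodMk (Measurable.iSup fun n => measurable_natFiltration hXm
        (TopologicalSpace.denseSeq (Set.Iic t) n).2) (measurable_natFiltration hXm le_rfl)
    have hG : Measurable fun p : (ℝ × ℝ) × ℝ => ψ (max p.1.1 (p.1.2 + p.2)) *
        Real.exp (lam * max p.1.1 (p.1.2 + p.2)) / (2 * lam) :=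
      hg.comp (measurable_fst.fst.max (measurable_fst.snd.add measurable_snd))
    have hae : (fun ω => ψ (Sinf ω) * Real.exp (lam * Sinf ω) / (2 * lam)) =ᵐ[P]
        fun ω => (fun p : (ℝ × ℝ) × ℝ => ψ (max p.1.1 (p.1.2 + p.2)) *
          Real.exp (lam * max p.1.1 (p.1.2 + p.2)) / (2 * lam))
          ((⨆ n, X (TopologicalSpace.denseSeq (Set.Iic t) n) ω, X t ω),
            maxDriftIncr B lam t ω) := by
      filter_upwards [hsplit t, hrun] with ω hω hrunω
      simp only [hω, ← hrunω]
    rw [hfilt]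
    refine (condExp_congr_ae hae).trans ((condExp_comp_maxDriftIncr hlam hB t hV hG
      (hint.congr hae)).trans ?_)
    filter_upwards [hrun, hXcont] with ω hrunω hcont
    simp only [← hrunω]
    exact integral_kennedy_expMeasure hlam (hψint _) (le_runSup hcont)

end
end
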